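/- For every a = (a_n)_{n≥N} ∈ lim→ 𝔪_n there exists a constant c(a) such that v(a_n) ≥ nf − c(a) for all n ≥ N. -/

import Mathlib

open Polynomial
open scoped Classical

namespace ColemanDrinfeld

variable {Cp : Type*} [NontriviallyNormedField Cp] [CompleteSpace Cp]

/-- Additive valuation on `Cp` normalized so that `v(F_𝔭^*) = ℤ`:
`v x = -log ‖x‖ / log q_𝔭`, with `v 0 = ⊤`. -/
noncomputable def val (qp : ℕ) (x : Cp) : WithTop ℝ :=
  if x = 0 then ⊤ else ((-(Real.log ‖x‖ / Real.log qp) : ℝ) : WithTop ℝ)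

/-- Evaluation of a polynomial, as a function. -/
def ev (P : Polynomial Cp) (z : Cp) : Cp := P.eval z

/-- The `𝔭^{fk}`-torsion `Φ[𝔭^{fk}]`: the zeros of the `k`-fold iterate of `Φ_η`. -/
def tors (P : Polynomial Cp) (k : ℕ) : Set Cp := {u : Cp | (ev P)^[k] u = 0}

/-- The punctured open unit ball `B' = {z : 0 < |z| < 1}`. -/
def inB' (z : Cp) : Prop := z ≠ 0 ∧ ‖z‖ < 1

/-- Field trace for an extension of subfields of `Cp`. -/
noncomputable def tr {E L : Subfield Cp} (h : E ≤ L) (x : L) : E :=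
  letI : Algebra E L := (Subfield.inclusion h).toAlgebra
  Algebra.trace E L x

/-- Field norm for an extension of subfields of `Cp`. -/
noncomputable def nrm {E L : Subfield Cp} (h : E ≤ L) (x : L) : E :=
  letI : Algebra E L := (Subfield.inclusion h).toAlgebra
  Algebra.norm E x

/-- A polynomial with integral coefficients maps the closed unit ball to itself. -/
theorem norm_eval_le_one [IsUltrametricDist Cp] (P : Polynomial Cp)
    (hP : ∀ i, ‖P.coeff i‖ ≤ 1) {x : Cp} (hx : ‖x‖ ≤ 1) : ‖P.eval x‖ ≤ 1 := by
  rw [eval_eq_sum_range]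
  refine IsUltrametricDist.norm_sum_le_of_forall_le_of_nonneg zero_le_one fun i _ => ?_
  rw [norm_mul, norm_pow]
  exact mul_le_one₀ (hP i) (by positivity) (pow_le_one₀ (norm_nonneg _) hx)

/-- A polynomial with integral coefficients and no constant term contracts the unit ball by at
least the larger of its linear coefficient and the argument. -/
theorem norm_eval_le_mul_max [IsUltrametricDist Cp] (P : Polynomial Cp)
    (hP : ∀ i, ‖P.coeff i‖ ≤ 1) (h0 : P.coeff 0 = 0) {x : Cp} (hx : ‖x‖ ≤ 1) :
    ‖P.eval x‖ ≤ max ‖P.coeff 1‖ ‖x‖ * ‖x‖ := by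
  have h : P.eval x = (P.divX.divX.eval x * x + P.coeff 1) * x := by
    conv_lhs => rw [← divX_mul_X_add P, ← divX_mul_X_add P.divX]
    simp [h0, coeff_divX]
  have hS : ‖P.divX.divX.eval x‖ ≤ 1 :=
    norm_eval_le_one _ (fun i => by simpa [coeff_divX] using hP _) hx
  rw [h, norm_mul]
  gcongr
  refine (IsUltrametricDist.norm_add_le_max _ _).trans ?_
  rw [max_comm, norm_mul]
  exact max_le_max le_rfl (mul_le_of_le_one_left (norm_nonneg _) hS)

/-- A normed field carrying a monic additive polynomial of degree at least two is ultrametric. -/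
theorem isUltrametricDist_of_additive (P : Polynomial Cp) (hmonic : P.Monic)
    (hdeg : 1 < P.natDegree)
    (hadd : ∀ x y : Cp, P.eval (x + y) = P.eval x + P.eval y) : IsUltrametricDist Cp := by
  refine IsUltrametricDist.isUltrametricDist_of_forall_norm_natCast_le_one fun n => ?_
  have hmul (x : Cp) : P.eval (n * x) = n * P.eval x := by
    let φ : Cp →+ Cp := AddMonoidHom.mk' (fun x => P.eval x) hadd
    simpa [φ, nsmul_eq_mul] using map_nsmul φ n x
  have hcomp : P.comp (C (n : Cp) * X) = C (n : Cp) * P :=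
    Polynomial.funext fun x => by simpa using hmul x
  have hcoeff := congrArg (fun Q => Q.coeff P.natDegree) hcomp
  simp only [comp_C_mul_X_coeff, coeff_C_mul, hmonic.coeff_natDegree, one_mul, mul_one] at hcoeff
  by_contra! hn
  have hlt := lt_self_pow₀ hn hdeg
  rw [← norm_pow, hcoeff] at hlt
  exact lt_irrefl _ hlt

/-- Orbits in the open unit ball of a map contracting by `max e ‖x‖` decay at least like `e ^ n`. -/
theorem exists_norm_mul_pow_le {e : ℝ} (he0 : 0 < e) (he1 : e < 1) {N : ℕ} {a : ℕ → Cp}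
    (ha : ∀ n, N ≤ n → ‖a n‖ < 1)
    (hrec : ∀ n, N ≤ n → ‖a (n + 1)‖ ≤ max e ‖a n‖ * ‖a n‖) :
    ∃ M : ℕ, ∀ n, N ≤ n → ‖a n‖ * e ^ M ≤ e ^ n := by
  set r := max e ‖a N‖ with hr
  have hr0 : 0 < r := he0.trans_le (le_max_left _ _)
  have hr1 : r < 1 := max_lt he1 (ha N le_rfl)
  have hle : ∀ k, ‖a (N + k)‖ ≤ r ^ k * ‖a N‖ := by
    intro k
    induction k with
    | zero => simp
    | succ k ih =>
      have hk : ‖a (N + k)‖ ≤ r :=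
        ih.trans ((mul_le_of_le_one_left (norm_nonneg _) (pow_le_one₀ hr0.le hr1.le)).trans
          (le_max_right _ _))
      calc ‖a (N + k + 1)‖ ≤ max e ‖a (N + k)‖ * ‖a (N + k)‖ := hrec _ (Nat.le_add_right _ _)
        _ ≤ r * (r ^ k * ‖a N‖) :=
          mul_le_mul (max_le (le_max_left _ _) hk) ih (norm_nonneg _) hr0.le
        _ = r ^ (k + 1) * ‖a N‖ := by ring
  obtain ⟨k, hk⟩ := exists_pow_lt_of_lt_one he0 hr1
  have hM : ‖a (N + k)‖ ≤ e :=
    (hle k).trans ((mul_le_of_le_one_right (by positivity) (ha N le_rfl).le).trans hk.le)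
  have hfast : ∀ j, ‖a (N + k + j)‖ ≤ e ^ (j + 1) := by
    intro j
    induction j with
    | zero => simpa using hM
    | succ j ih =>
      have hj : ‖a (N + k + j)‖ ≤ e :=
        ih.trans (pow_le_of_le_one he0.le he1.le j.succ_ne_zero)
      calc ‖a (N + k + j + 1)‖ ≤ max e ‖a (N + k + j)‖ * ‖a (N + k + j)‖ :=
            hrec _ (by omega)
        _ ≤ e * e ^ (j + 1) := mul_le_mul (max_le le_rfl hj) ih (norm_nonneg _) he0.le
        _ = e ^ (j + 1 + 1) := by ring
  refine ⟨N + k, fun n hn => ?_⟩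
  rcases le_total n (N + k) with h | h
  · calc ‖a n‖ * e ^ (N + k) ≤ 1 * e ^ n :=
        mul_le_mul (ha n hn).le (pow_le_pow_of_le_one he0.le he1.le h) (by positivity) zero_le_one
      _ = e ^ n := one_mul _
  · obtain ⟨j, rfl⟩ := Nat.exists_eq_add_of_le h
    calc ‖a (N + k + j)‖ * e ^ (N + k) ≤ e ^ j * e ^ (N + k) := by
          gcongr
          exact (hfast j).trans (pow_le_pow_of_le_one he0.le he1.le j.le_succ)
      _ = e ^ (N + k + j) := by ring

/-- A norm bound by a power of `q_𝔭` is a lower bound for the valuation. -/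
theorem le_val_of_norm_mul_pow_le {qp : ℕ} (hqp : 1 < qp) (f : ℕ) {x : Cp} {M n : ℕ}
    (h : ‖x‖ * ((qp : ℝ) ^ (-(f : ℤ))) ^ M ≤ ((qp : ℝ) ^ (-(f : ℤ))) ^ n) :
    ((((n : ℝ) * f - (M : ℝ) * f) : ℝ) : WithTop ℝ) ≤ val qp x := by
  unfold val
  split_ifs with hx
  · exact le_top
  · have hq0 : (0 : ℝ) < qp := by positivity
    have hlog : 0 < Real.log qp := Real.log_pos (by exact_mod_cast hqp)
    have hx0 : 0 < ‖x‖ := norm_pos_iff.mpr hx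
    have hl := Real.log_le_log (by positivity) h
    rw [Real.log_mul hx0.ne' (by positivity), Real.log_pow, Real.log_pow, Real.log_zpow] at hl
    push_cast at hl
    rw [WithTop.coe_le_coe, ← neg_div, le_div_iff₀ hlog]
    linarith

theorem direct_limit_valuation_bound
    (q qp f : ℕ) (hq : 1 < q) (hqp : 1 < qp) (hf : 0 < f)
    (Fp K : Subfield Cp) (hFpK : Fp ≤ K)
    (η : Cp) (hηF : η ∈ Fp) (hηnorm : ‖η‖ = (qp : ℝ) ^ (-(f : ℤ)))
    (Φη : Polynomial Cp) (hmonic : Φη.Monic) (hdeg : Φη.natDegree = qp ^ f)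
    (hcoeffK : ∀ i, Φη.coeff i ∈ K) (hcoeffint : ∀ i, ‖Φη.coeff i‖ ≤ 1)
    (hcoeffm : ∀ i, i < qp ^ f → ‖Φη.coeff i‖ < 1)
    (haddpoly : ∀ x y : Cp, Φη.eval (x + y) = Φη.eval x + Φη.eval y)
    (hlin : Φη.coeff 1 = η)
    (Kn : ℕ → Subfield Cp)
    (hKKn : ∀ n, 1 ≤ n → K ≤ Kn n)
    (hKnle : ∀ m n, 1 ≤ m → m ≤ n → Kn m ≤ Kn n)
    (hKnGen : ∀ n, 1 ≤ n → Kn n = Subfield.closure ((K : Set Cp) ∪ tors Φη n))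
    (ω : ℕ → Cp)
    (hωev : ∀ n, 1 ≤ n → ev Φη (ω (n + 1)) = ω n)
    (hωtors : ∀ n, 1 ≤ n → (ev Φη)^[n] (ω n) = 0)
    (hωprim : ∀ n, 1 ≤ n → (ev Φη)^[n - 1] (ω n) ≠ 0)
    (hωmem : ∀ n, 1 ≤ n → ω n ∈ Kn n)
    (N₀ : ℕ) (hN₀ : 1 ≤ N₀) (a : ℕ → Cp)
    (haK : ∀ n, N₀ ≤ n → a n ∈ Kn n) (ham : ∀ n, N₀ ≤ n → ‖a n‖ < 1)
    (harec : ∀ n, N₀ ≤ n → a (n + 1) = ev Φη (a n))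
    :
    ∃ C : ℝ, ∀ n, N₀ ≤ n → ((((n : ℝ) * f - C) : ℝ) : WithTop ℝ) ≤ val qp (a n) := by
  have hd : 1 < Φη.natDegree := hdeg ▸ Nat.one_lt_pow hf.ne' hqp
  have : IsUltrametricDist Cp := isUltrametricDist_of_additive Φη hmonic hd haddpoly
  have h0 : Φη.coeff 0 = 0 := by
    rw [coeff_zero_eq_eval_zero]
    simpa using haddpoly 0 0
  have hη0 : 0 < ‖η‖ := by rw [hηnorm]; positivity
  have hη1 : ‖η‖ < 1 := hlin ▸ hcoeffm 1 (hdeg ▸ hd)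
  obtain ⟨M, hM⟩ := exists_norm_mul_pow_le hη0 hη1 ham fun n hn => by
    rw [harec n hn, ← hlin]
    exact norm_eval_le_mul_max Φη hcoeffint h0 (ham n hn).le
  refine ⟨(M : ℝ) * f, fun n hn => le_val_of_norm_mul_pow_le hqp f ?_⟩
  rw [← hηnorm]
  exact hM n hn

end ColemanDrinfeld
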